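/- arXiv:2107.00774 — 8 statements merged into one kernel-verified Lean document; each statement's English description precedes it below -/
import Mathlib

section
/- Let d ≥ 1 and k ≥ 2 be integers, let M ⊆ ℝ^d be a finite set of cluster centers with 2 ≤ |M| ≤ k, and let X ⊆ ℝ^d be a finite set of points with an assignment c : X → M. Then there exist a coordinate r ∈ {1,…,d} and a threshold t ∈ [a_r, b_r] such that E(r,t) ≤ 15·(ln k)·f(r,t)·(∑_{x∈X} ‖x − c(x)‖₂²)/(∑_{r'=1}^d R_{r'}²). -/
open Finset

lemma aux_harm (n : ℕ) :
    ∑ i ∈ range n, (1 / ((min (i+1) (n-i) : ℕ) : ℝ)) ≤ 2 * (1 + Real.log n) := by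
  have h1 : ∑ i ∈ range n, (1 / ((i : ℝ) + 1)) ≤ 1 + Real.log n := by
    have := harmonic_le_one_add_log n
    simpa [harmonic] using this
  have h2 : ∑ i ∈ range n, (1 / ((n - i : ℕ) : ℝ)) = ∑ i ∈ range n, (1 / ((i : ℝ) + 1)) := by
    rw [← Finset.sum_range_reflect]
    apply Finset.sum_congr rfl
    intro i hi
    have hi' := Finset.mem_range.1 hi
    have : n - (n - 1 - i) = i + 1 := by omega
    rw [this]; push_cast; rfl
  have h3 : ∑ i ∈ range n, (1 / ((min (i+1) (n-i) : ℕ) : ℝ)) ≤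
      ∑ i ∈ range n, (1 / ((i : ℝ) + 1) + 1 / ((n - i : ℕ) : ℝ)) := by
    apply Finset.sum_le_sum
    intro i _
    have e1 : (0:ℝ) ≤ 1 / ((i : ℝ) + 1) := by positivity
    have e2 : (0:ℝ) ≤ 1 / ((n - i : ℕ) : ℝ) := by positivity
    rcases le_total (i+1) (n-i) with h | h
    · rw [min_eq_left h]; push_cast; linarith
    · rw [min_eq_right h]; linarith
  rw [Finset.sum_add_distrib, h2] at h3
  linarith

lemma aux_int (p q : ℝ) : ∫ t in p..q, (t - p) * (q - t) = (q - p)^3 / 6 := by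
  have : ∀ t ∈ Set.uIcc p q, HasDerivAt (fun t : ℝ => (t-p)^2/2*(q-p) - (t-p)^3/3)
      ((t - p) * (q - t)) t := by
    intro t _
    have h := (hasDerivAt_id t).sub_const p
    have := (((h.pow 2).div_const 2).mul_const (q-p)).sub ((h.pow 3).div_const 3)
    refine HasDerivAt.congr_deriv this ?_
    simp only [id]; push_cast; ring
  rw [intervalIntegral.integral_eq_sub_of_hasDerivAt this]
  · ring
  · apply Continuous.intervalIntegrable; fun_prop

lemma aux_abs (x c : ℝ) : ∫ t in Set.uIoc x c, |t - c| = (x - c)^2/2 := by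
  rcases le_total x c with h | h
  · rw [Set.uIoc_of_le h, ← intervalIntegral.integral_of_le h]
    rw [intervalIntegral.integral_congr (g := fun t => c - t)]
    · have : ∀ t ∈ Set.uIcc x c, HasDerivAt (fun t : ℝ => -(c - t)^2/2) (c - t) t := by
        intro t _
        have := (((hasDerivAt_id t).const_sub c).pow 2).neg.div_const 2
        refine HasDerivAt.congr_deriv this ?_
        simp only [id]; push_cast; ring
      rw [intervalIntegral.integral_eq_sub_of_hasDerivAt this]
      · ring
      · apply Continuous.intervalIntegrable; fun_prop
    · intro t ht
      rw [Set.uIcc_of_le h] at ht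
      simp only
      rw [abs_of_nonpos (by linarith [ht.2])]; ring
  · rw [Set.uIoc_of_ge h, ← intervalIntegral.integral_of_le h]
    rw [intervalIntegral.integral_congr (g := fun t => t - c)]
    · have : ∀ t ∈ Set.uIcc c x, HasDerivAt (fun t : ℝ => (t - c)^2/2) (t - c) t := by
        intro t _
        have := (((hasDerivAt_id t).sub_const c).pow 2).div_const 2
        refine HasDerivAt.congr_deriv this ?_
        simp only [id]; push_cast; ring
      rw [intervalIntegral.integral_eq_sub_of_hasDerivAt this]
      · ring
      · apply Continuous.intervalIntegrable; fun_prop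
    · intro t ht
      rw [Set.uIcc_of_le h] at ht
      simp only
      rw [abs_of_nonneg (by linarith [ht.1])]

lemma aux_seq (n : ℕ) (y : ℕ → ℝ) (hy : ∀ i < n, y i < y (i+1)) (G : ℝ → ℝ) (l : ℝ) (hl : 0 ≤ l)
    (hG : ∀ i < n, IntervalIntegrable G MeasureTheory.volume (y i) (y (i+1)))
    (hb : ∀ i < n, ∀ t ∈ Set.Icc (y i) (y (i+1)),
      l * ((min (i+1) (n-i) : ℕ) : ℝ) * ((t - y i) * (y (i+1) - t) / (y (i+1) - y i)) ≤ G t) :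
    l * (y n - y 0)^2 ≤ 12 * (1 + Real.log n) * ∫ t in (y 0)..(y n), G t := by
  have hsum := intervalIntegral.sum_integral_adjacent_intervals hG
  have hcs : (∑ i ∈ range n, (y (i+1) - y i))^2 ≤
      (∑ i ∈ range n, ((min (i+1) (n-i) : ℕ) : ℝ) * (y (i+1) - y i)^2) *
      (∑ i ∈ range n, (1 / ((min (i+1) (n-i) : ℕ) : ℝ))) := by
    apply Finset.sum_sq_le_sum_mul_sum_of_sq_le_mul
    · intros; positivity
    · intros; positivity
    · intro i hi
      have hi' := Finset.mem_range.1 hi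
      have : (0:ℝ) < ((min (i+1) (n-i) : ℕ) : ℝ) := by
        have : 0 < min (i+1) (n-i) := by omega
        exact_mod_cast this
      apply le_of_eq
      field_simp
  rw [Finset.sum_range_sub] at hcs
  have hI : l * ∑ i ∈ range n, ((min (i+1) (n-i) : ℕ) : ℝ) * (y (i+1) - y i)^2 ≤
      6 * ∫ t in (y 0)..(y n), G t := by
    rw [← hsum, Finset.mul_sum, Finset.mul_sum]
    apply Finset.sum_le_sum
    intro i hi
    have hi' := Finset.mem_range.1 hi
    have hlt := hy i hi'
    have := intervalIntegral.integral_mono_on hlt.le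
      (by apply Continuous.intervalIntegrable; fun_prop) (hG i hi') (hb i hi')
    rw [intervalIntegral.integral_const_mul, intervalIntegral.integral_div, aux_int] at this
    have hne : y (i+1) - y i ≠ 0 := by linarith
    have e : (y (i+1) - y i)^3/6/(y (i+1) - y i) = (y (i+1) - y i)^2/6 := by field_simp
    rw [e] at this
    linarith
  have hA : 0 ≤ ∑ i ∈ range n, ((min (i+1) (n-i) : ℕ) : ℝ) * (y (i+1) - y i)^2 :=
    Finset.sum_nonneg (fun i _ => by positivity)
  have hlog : 0 ≤ Real.log n := Real.log_natCast_nonneg n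
  calc l * (y n - y 0)^2 ≤ l * ((∑ i ∈ range n, ((min (i+1) (n-i) : ℕ) : ℝ) * (y (i+1) - y i)^2) *
      (2 * (1 + Real.log n))) := by
        apply mul_le_mul_of_nonneg_left _ hl
        exact hcs.trans (mul_le_mul_of_nonneg_left (aux_harm n) hA)
    _ = (l * ∑ i ∈ range n, ((min (i+1) (n-i) : ℕ) : ℝ) * (y (i+1) - y i)^2) *
      (2 * (1 + Real.log n)) := by ring
    _ ≤ (6 * ∫ t in (y 0)..(y n), G t) * (2 * (1 + Real.log n)) := by
        apply mul_le_mul_of_nonneg_right hI; positivity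
    _ = _ := by ring

lemma aux_set (Y : Finset ℝ) (a b : ℝ) (ha : IsLeast (Y : Set ℝ) a) (hb : IsGreatest (Y : Set ℝ) b)
    (G : ℝ → ℝ) (l : ℝ) (hl : 0 ≤ l) (hG : MeasureTheory.Integrable G)
    (hGb : ∀ t ∈ Set.Icc a b, l * ((min (Y.filter (fun v => v ≤ t)).card
      (Y.filter (fun v => t ≤ v)).card : ℕ) : ℝ) * Metric.infDist t (Y : Set ℝ) ≤ G t) :
    l * (b - a)^2 ≤ 12 * (1 + Real.log Y.card) * ∫ t in a..b, G t := by
  have hne : Y.Nonempty := ⟨a, ha.1⟩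
  have hpos : 0 < Y.card := hne.card_pos
  obtain ⟨n, hn⟩ : ∃ n, Y.card = n + 1 := ⟨Y.card - 1, by omega⟩
  let o := Y.orderEmbOfFin hn
  let y : ℕ → ℝ := fun i => if h : i < n + 1 then o ⟨i, h⟩ else 0
  have hyo : ∀ i (h : i < n + 1), y i = o ⟨i, h⟩ := fun i h => dif_pos h
  clear_value y
  have hylt : ∀ i j, i < j → j < n + 1 → y i < y j := by
    intro i j hij hj
    rw [hyo i (by omega), hyo j hj]
    exact o.strictMono (by simpa using hij)
  have hyle : ∀ i j, i ≤ j → j < n + 1 → y i ≤ y j := by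
    intro i j hij hj
    rcases hij.eq_or_lt with h | h
    · rw [h]
    · exact (hylt i j h hj).le
  have hymem : ∀ i, i < n + 1 → y i ∈ Y := by
    intro i hi; rw [hyo i hi]; exact Finset.orderEmbOfFin_mem Y hn _
  have hysurj : ∀ v ∈ Y, ∃ i < n + 1, y i = v := by
    intro v hv
    have : v ∈ Set.range o := by rw [Finset.range_orderEmbOfFin]; exact hv
    obtain ⟨i, hi⟩ := this
    exact ⟨i, i.2, by rw [hyo i i.2]; exact hi⟩
  have hy0 : y 0 = a := by
    apply le_antisymm
    · obtain ⟨i, hi, h⟩ := hysurj a ha.1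
      rw [← h]; exact hyle 0 i (by omega) hi
    · exact ha.2 (hymem 0 (by omega))
  have hyn : y n = b := by
    apply le_antisymm
    · exact hb.2 (hymem n (by omega))
    · obtain ⟨i, hi, h⟩ := hysurj b hb.1
      rw [← h]; exact hyle i n (by omega) (by omega)
  have hinj : ∀ i < n+1, ∀ j < n+1, y i = y j → i = j := by
    intro i hi j hj h
    rcases lt_trichotomy i j with h' | h' | h'
    · exact absurd h (hylt i j h' hj).ne
    · exact h'
    · exact absurd h (hylt j i h' hi).ne'
  have key := aux_seq n y (fun i hi => hylt i (i+1) (by omega) (by omega)) G l hl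
    (fun i _ => hG.intervalIntegrable) ?_
  · rw [hy0, hyn] at key
    rcases Nat.eq_zero_or_pos n with h0 | h0
    · have : a = b := by rw [← hy0, ← hyn, h0]
      rw [this]; rw [intervalIntegral.integral_same, sub_self]; simp
    have hIn : 0 ≤ ∫ t in a..b, G t := by
      apply intervalIntegral.integral_nonneg (ha.2 hb.1)
      intro t ht
      refine le_trans ?_ (hGb t ht)
      have := Metric.infDist_nonneg (x := t) (s := (Y : Set ℝ))
      positivity
    refine key.trans ?_
    apply mul_le_mul_of_nonneg_right _ hIn
    have : Real.log n ≤ Real.log Y.card := by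
      apply Real.log_le_log
      · exact_mod_cast h0
      · rw [hn]; push_cast; linarith
    linarith
  · intro i hi t ht
    have hab : t ∈ Set.Icc a b := by
      rw [← hy0, ← hyn]
      exact ⟨(hyle 0 i (by omega) (by omega)).trans ht.1,
        ht.2.trans (hyle (i+1) n (by omega) (by omega))⟩
    refine le_trans ?_ (hGb t hab)
    have hg : 0 < y (i+1) - y i := by linarith [hylt i (i+1) (by omega) (by omega)]
    have hc1 : i + 1 ≤ (Y.filter (fun v => v ≤ t)).card := by
      have := Finset.card_le_card_of_injOn (s := range (i+1)) (t := Y.filter (fun v => v ≤ t)) y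
        (by
          intro j hj
          have hj' := Finset.mem_range.1 (Finset.mem_coe.1 hj)
          simp only [Finset.coe_filter, Set.mem_ofPred_eq]
          exact ⟨hymem j (by omega), (hyle j i (by omega) (by omega)).trans ht.1⟩)
        (by
          intro j hj j' hj' h
          have h1 := Finset.mem_range.1 (Finset.mem_coe.1 hj)
          have h2 := Finset.mem_range.1 (Finset.mem_coe.1 hj')
          exact hinj j (by omega) j' (by omega) h)
      simpa using this
    have hc2 : n - i ≤ (Y.filter (fun v => t ≤ v)).card := by
      have := Finset.card_le_card_of_injOn (s := Finset.Ico (i+1) (n+1))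
        (t := Y.filter (fun v => t ≤ v)) y
        (by
          intro j hj
          have hj' := Finset.mem_Ico.1 (Finset.mem_coe.1 hj)
          simp only [Finset.coe_filter, Set.mem_ofPred_eq]
          exact ⟨hymem j (by omega), ht.2.trans (hyle (i+1) j (by omega) (by omega))⟩)
        (by
          intro j hj j' hj' h
          have h1 := Finset.mem_Ico.1 (Finset.mem_coe.1 hj)
          have h2 := Finset.mem_Ico.1 (Finset.mem_coe.1 hj')
          exact hinj j (by omega) j' (by omega) h)
      simpa using this
    have hmin : ((min (i+1) (n-i) : ℕ) : ℝ) ≤ ((min (Y.filter (fun v => v ≤ t)).card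
      (Y.filter (fun v => t ≤ v)).card : ℕ) : ℝ) := by
      exact_mod_cast min_le_min hc1 hc2
    have ht1 : 0 ≤ t - y i := by linarith [ht.1]
    have ht2 : 0 ≤ y (i+1) - t := by linarith [ht.2]
    have hinf : (t - y i) * (y (i+1) - t) / (y (i+1) - y i) ≤ Metric.infDist t (Y : Set ℝ) := by
      rw [Metric.le_infDist (by exact_mod_cast hne)]
      intro v hv
      obtain ⟨j, hj, rfl⟩ := hysurj v hv
      rw [div_le_iff₀ hg, Real.dist_eq]
      rcases Nat.lt_or_ge i j with h | h
      · have := hyle (i+1) j (by omega) hj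
        have h3 : y (i+1) - t ≤ |t - y j| := by
          rw [abs_sub_comm]; exact le_trans (by linarith) (le_abs_self _)
        nlinarith
      · have := hyle j i h (by omega)
        have h3 : t - y i ≤ |t - y j| := le_trans (by linarith) (le_abs_self _)
        nlinarith
    have hq : 0 ≤ (t - y i) * (y (i+1) - t) / (y (i+1) - y i) := by positivity
    apply mul_le_mul _ hinf hq (by positivity)
    exact mul_le_mul_of_nonneg_left hmin hl

open MeasureTheory in
lemma aux_one {α : Type*} (Y : Finset ℝ) (a b : ℝ) (ha : IsLeast (Y : Set ℝ) a)
    (hb : IsGreatest (Y : Set ℝ) b) (X : Finset α) (p q : α → ℝ) (hq : ∀ x ∈ X, q x ∈ Y)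
    (l : ℝ) (hl : 0 ≤ l)
    (h : ∀ t ∈ Set.Icc a b, l * ((min (Y.filter (fun v => v ≤ t)).card
      (Y.filter (fun v => t ≤ v)).card : ℕ) : ℝ) ≤
      ((X.filter (fun x => (p x < t ∧ t ≤ q x) ∨ (q x < t ∧ t ≤ p x))).card : ℝ)) :
    l * (b - a)^2 ≤ 12 * (1 + Real.log Y.card) * ∑ x ∈ X, (p x - q x)^2 / 2 := by
  classical
  set w : ℝ → ℝ := fun t => Metric.infDist t (Y : Set ℝ) with hw
  have hwc : Continuous w := Metric.continuous_infDist_pt _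
  have hw0 : ∀ t, 0 ≤ w t := fun t => Metric.infDist_nonneg
  let G : ℝ → ℝ := fun t => ∑ x ∈ X, (Set.uIoc (p x) (q x)).indicator w t
  have hint : ∀ x, Integrable ((Set.uIoc (p x) (q x)).indicator w) := by
    intro x
    rw [integrable_indicator_iff measurableSet_uIoc]
    exact (hwc.integrableOn_uIcc).mono_set Set.uIoc_subset_uIcc
  have hGint : Integrable G := integrable_finsetSum _ (fun x _ => hint x)
  have hGe : ∀ t, G t =
      ((X.filter (fun x => (p x < t ∧ t ≤ q x) ∨ (q x < t ∧ t ≤ p x))).card : ℝ) * w t := by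
    intro t
    simp only [G, Finset.card_filter, Set.indicator_apply, Set.mem_uIoc]
    push_cast
    rw [Finset.sum_mul]
    apply Finset.sum_congr rfl
    intro x _
    split_ifs <;> simp
  have key := aux_set Y a b ha hb G l hl hGint (by
    intro t ht
    rw [hGe]
    exact mul_le_mul_of_nonneg_right (h t ht) (hw0 t))
  refine key.trans ?_
  have hlog : 0 ≤ Real.log Y.card := Real.log_natCast_nonneg _
  apply mul_le_mul_of_nonneg_left _ (by positivity)
  rw [intervalIntegral.integral_of_le (ha.2 hb.1)]
  have hG0 : ∀ t, 0 ≤ G t := fun t => Finset.sum_nonneg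
    (fun x _ => Set.indicator_nonneg (fun t _ => hw0 t) t)
  calc ∫ t in Set.Ioc a b, G t ≤ ∫ t, G t :=
        setIntegral_le_integral hGint (Filter.Eventually.of_forall hG0)
    _ = ∑ x ∈ X, ∫ t, (Set.uIoc (p x) (q x)).indicator w t := integral_finsetSum _ (fun x _ => hint x)
    _ ≤ ∑ x ∈ X, (p x - q x)^2/2 := by
        apply Finset.sum_le_sum
        intro x hx
        rw [integral_indicator measurableSet_uIoc, ← aux_abs]
        apply setIntegral_mono
        · exact (hwc.integrableOn_uIcc).mono_set Set.uIoc_subset_uIcc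
        · have : Continuous (fun t : ℝ => |t - q x|) := by fun_prop
          exact (this.integrableOn_uIcc).mono_set Set.uIoc_subset_uIcc
        · intro t
          have := Metric.infDist_le_dist_of_mem (x := t) (Finset.mem_coe.2 (hq x hx))
          rwa [Real.dist_eq] at this

/-- Main lemma for explainable `k`-means: for a finite set `M` of cluster centers in `ℝ^d`
with `2 ≤ |M| ≤ k`, and a finite set `X` of points assigned by `c` to centers in `M`,
there is a coordinate `r` and a threshold `t ∈ [a_r, b_r]` such that the number `E(r,t)` of
misclassified points satisfies
`E(r,t) ≤ 15 (ln k) f(r,t) (∑_{x∈X} ‖x − c(x)‖²) / (∑_{r'} R_{r'}²)`. -/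
theorem stmt_0 (d k : ℕ) (hd : 1 ≤ d) (hk : 2 ≤ k)
    (M X : Finset (EuclideanSpace ℝ (Fin d)))
    (hMcard : 2 ≤ M.card) (hMk : M.card ≤ k)
    (c : EuclideanSpace ℝ (Fin d) → EuclideanSpace ℝ (Fin d))
    (hc : ∀ x ∈ X, c x ∈ M)
    (a b R : Fin d → ℝ)
    (ha : ∀ r, IsLeast {v : ℝ | ∃ μ ∈ M, μ r = v} (a r))
    (hb : ∀ r, IsGreatest {v : ℝ | ∃ μ ∈ M, μ r = v} (b r))
    (hR : ∀ r, R r = b r - a r) :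
    ∃ r : Fin d, ∃ t : ℝ, a r ≤ t ∧ t ≤ b r ∧
      (((X.filter (fun x => (x r < t ∧ t ≤ c x r) ∨ (c x r < t ∧ t ≤ x r))).card : ℝ) ≤
        15 * Real.log k *
          ((min (M.filter (fun μ => μ r ≤ t)).card (M.filter (fun μ => t ≤ μ r)).card : ℕ) : ℝ) *
          ((∑ x ∈ X, ‖x - c x‖ ^ 2) / (∑ r' : Fin d, R r' ^ 2))) := by
  classical
  by_contra hcon
  push Not at hcon
  set C : ℝ := ∑ x ∈ X, ‖x - c x‖ ^ 2 with hC
  set S : ℝ := ∑ r' : Fin d, R r' ^ 2 with hS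
  have hCs : C = ∑ r : Fin d, ∑ x ∈ X, (x r - c x r)^2 := by
    rw [Finset.sum_comm, hC]
    apply Finset.sum_congr rfl
    intro x _
    rw [EuclideanSpace.real_norm_sq_eq]
    simp
  have hC0 : 0 ≤ C := Finset.sum_nonneg (fun x _ => by positivity)
  have hS0 : 0 ≤ S := Finset.sum_nonneg (fun x _ => by positivity)
  have hL : 0.69 < Real.log k := by
    have h1 : Real.log 2 ≤ Real.log k := Real.log_le_log (by norm_num) (by exact_mod_cast hk)
    linarith [Real.log_two_gt_d9]
  have hSpos : 0 < S := by
    obtain ⟨u, hu, v, hv, huv⟩ := Finset.one_lt_card.1 (show 1 < M.card by omega)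
    obtain ⟨r, hr⟩ : ∃ r, u r ≠ v r := by
      by_contra hh
      push Not at hh
      exact huv (by ext r; exact hh r)
    have hRr : R r ≠ 0 := by
      intro h0
      have h1 := (ha r).2 ⟨u, hu, rfl⟩
      have h2 := (ha r).2 ⟨v, hv, rfl⟩
      have h3 := (hb r).2 ⟨u, hu, rfl⟩
      have h4 := (hb r).2 ⟨v, hv, rfl⟩
      have h5 := hR r
      exact hr (by linarith)
    exact Finset.sum_pos' (fun i _ => by positivity) ⟨r, Finset.mem_univ r, by positivity⟩
  set l : ℝ := 15 * Real.log k * (C / S) with hl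
  have hl0 : 0 ≤ l := by positivity
  have hr : ∀ r : Fin d, l * R r ^ 2 ≤
      12 * (1 + Real.log k) * ∑ x ∈ X, (x r - c x r)^2/2 := by
    intro r
    let Y : Finset ℝ := M.image (fun μ => μ r)
    have hYs : (Y : Set ℝ) = {v : ℝ | ∃ μ ∈ M, μ r = v} := by
      ext v; simp [Y]
    have hYc : Y.card ≤ k := Finset.card_image_le.trans hMk
    have key := aux_one Y (a r) (b r) (hYs ▸ ha r) (hYs ▸ hb r) X (fun x => x r)
      (fun x => c x r) (fun x hx => Finset.mem_image_of_mem _ (hc x hx)) l hl0 (by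
        intro t ht
        refine le_trans ?_ (hcon r t ht.1 ht.2).le
        have h1 : (Y.filter (fun v => v ≤ t)).card ≤ (M.filter (fun μ => μ r ≤ t)).card := by
          rw [Finset.filter_image]; exact Finset.card_image_le
        have h2 : (Y.filter (fun v => t ≤ v)).card ≤ (M.filter (fun μ => t ≤ μ r)).card := by
          rw [Finset.filter_image]; exact Finset.card_image_le
        have h3 : ((min (Y.filter (fun v => v ≤ t)).card
            (Y.filter (fun v => t ≤ v)).card : ℕ) : ℝ) ≤
            ((min (M.filter (fun μ => μ r ≤ t)).card (M.filter (fun μ => t ≤ μ r)).card : ℕ) : ℝ) := by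
          exact_mod_cast min_le_min h1 h2
        have h4 := mul_le_mul_of_nonneg_left h3 hl0
        refine h4.trans (le_of_eq ?_)
        rw [hl]; ring)
    rw [hR r]
    refine key.trans ?_
    apply mul_le_mul_of_nonneg_right _ (Finset.sum_nonneg (fun x _ => by positivity))
    have hYpos : 0 < Y.card := by
      apply Finset.card_pos.2
      exact ⟨a r, by rw [← Finset.mem_coe, hYs]; exact (ha r).1⟩
    have : Real.log Y.card ≤ Real.log k :=
      Real.log_le_log (by exact_mod_cast hYpos) (by exact_mod_cast hYc)
    linarith
  have hsum := Finset.sum_le_sum (fun r (_ : r ∈ (Finset.univ : Finset (Fin d))) => hr r)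
  simp only [← Finset.sum_div] at hsum
  rw [← Finset.mul_sum, ← Finset.mul_sum, ← Finset.sum_div, ← hCs, ← hS] at hsum
  have hlS : l * S = 15 * Real.log k * C := by
    rw [hl]; field_simp
  rw [hlS] at hsum
  have hCz : C = 0 := by nlinarith
  have hx : ∀ x ∈ X, x = c x := by
    intro x hx
    have := (Finset.sum_eq_zero_iff_of_nonneg (fun x _ => by positivity)).1 (hC ▸ hCz) x hx
    have h2 : ‖x - c x‖ = 0 := by simpa using this
    exact sub_eq_zero.1 (norm_eq_zero.1 h2)
  have hlast := hcon ⟨0, hd⟩ (a ⟨0, hd⟩) le_rfl ((ha _).2 (hb _).1)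
  rw [hCz, zero_div, mul_zero] at hlast
  obtain ⟨x, hxm⟩ := Finset.card_pos.1 (Nat.cast_pos.1 hlast)
  obtain ⟨hxX, hxx⟩ := Finset.mem_filter.1 hxm
  rw [← hx x hxX] at hxx
  rcases hxx with h | h <;> linarith [h.1, h.2]
end

section
/- Let d ≥ 1 and k ≥ 2 be integers, let M ⊆ ℝ^d be a finite set of cluster centers with 2 ≤ |M| ≤ k, and let X ⊆ ℝ^d be a finite set of points with an assignment c : X → M. For r ∈ {1,…,d} and t ∈ [a_r, b_r], let A(r,t) denote the condition that |t − μ_r| ≥ R_r/(10·(ln k)·f(r,t)) for every μ ∈ M, and let 1_{A(r,t)} be its indicator. Then ∑_{r=1}^d ∫_{a_r}^{b_r} R_r · (E(r,t)/f(r,t)) · 1_{A(r,t)} dt ≤ 5·(ln k)·∑_{x∈X} ‖x − c(x)‖₂², where the integral is with respect to Lebesgue measure on [a_r, b_r]. -/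
open Finset MeasureTheory

/-- The integral bound behind the main `k`-means lemma: with `A(r,t)` the event that
`|t − μ_r| ≥ R_r / (10 (ln k) f(r,t))` for all `μ ∈ M`, we have
`∑_r ∫_{a_r}^{b_r} R_r (E(r,t)/f(r,t)) 1_{A(r,t)} dt ≤ 5 (ln k) ∑_{x∈X} ‖x − c(x)‖²`. -/
theorem stmt_1 (d k : ℕ) (hd : 1 ≤ d) (hk : 2 ≤ k)
    (M X : Finset (EuclideanSpace ℝ (Fin d)))
    (hMcard : 2 ≤ M.card) (hMk : M.card ≤ k)
    (c : EuclideanSpace ℝ (Fin d) → EuclideanSpace ℝ (Fin d))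
    (hc : ∀ x ∈ X, c x ∈ M)
    (a b R : Fin d → ℝ)
    (ha : ∀ r, IsLeast {v : ℝ | ∃ μ ∈ M, μ r = v} (a r))
    (hb : ∀ r, IsGreatest {v : ℝ | ∃ μ ∈ M, μ r = v} (b r))
    (hR : ∀ r, R r = b r - a r)
    -- `f r t` : the min of the number of centers on either side of the split `{x_r = t}`
    (f : Fin d → ℝ → ℕ)
    (hf : ∀ r t, f r t =
      min (M.filter (fun μ => μ r ≤ t)).card (M.filter (fun μ => t ≤ μ r)).card)
    -- `E r t` : the number of points of `X` misclassified by the split `{x_r = t}`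
    (E : Fin d → ℝ → ℕ)
    (hE : ∀ r t, E r t =
      (X.filter (fun x => (x r < t ∧ t ≤ c x r) ∨ (c x r < t ∧ t ≤ x r))).card) :
    ∑ r : Fin d,
        ∫ t in (a r)..(b r),
          Set.indicator {t : ℝ | ∀ μ ∈ M, R r / (10 * Real.log k * (f r t : ℝ)) ≤ |t - μ r|}
            (fun t => R r * ((E r t : ℝ) / (f r t : ℝ))) t
      ≤ 5 * Real.log k * ∑ x ∈ X, ‖x - c x‖ ^ 2 := by
  have hL : 0 < Real.log k := Real.log_pos (by exact_mod_cast hk)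
  have hg : ∀ (p q : ℝ), Integrable
      ((Set.uIoc p q).indicator (fun t => 10 * Real.log k * |t - p|)) volume := by
    intro p q
    rw [integrable_indicator_iff measurableSet_uIoc]
    have hcont : Continuous (fun t : ℝ => 10 * Real.log k * |t - p|) := by fun_prop
    exact (hcont.intervalIntegrable p q).def'
  have hI : ∀ (p q : ℝ), ∫ t, (Set.uIoc p q).indicator (fun t => 10 * Real.log k * |t - p|) t
      = 5 * Real.log k * (q - p) ^ 2 := by
    intro p q
    rw [integral_indicator measurableSet_uIoc, integral_const_mul]
    have h := integral_pow_abs_sub_uIoc (a := p) (b := q) 1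
    simp only [pow_one] at h
    rw [h]
    norm_num
    ring
  have hg0 : ∀ (p q t : ℝ),
      0 ≤ (Set.uIoc p q).indicator (fun t => 10 * Real.log k * |t - p|) t := by
    intro p q t
    apply Set.indicator_nonneg
    intro t _
    positivity
  have key : ∀ r : Fin d, ∫ t in (a r)..(b r),
      Set.indicator {t : ℝ | ∀ μ ∈ M, R r / (10 * Real.log k * (f r t : ℝ)) ≤ |t - μ r|}
            (fun t => R r * ((E r t : ℝ) / (f r t : ℝ))) t
      ≤ ∑ x ∈ X, 5 * Real.log k * (x r - c x r) ^ 2 := by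
    intro r
    have hab : a r ≤ b r := (ha r).2 (hb r).1
    have hR0 : 0 ≤ R r := by rw [hR]; linarith
    rw [intervalIntegral.integral_of_le hab]
    have hGi : Integrable (fun t => ∑ x ∈ X,
        (Set.uIoc (c x r) (x r)).indicator (fun t => 10 * Real.log k * |t - c x r|) t) volume :=
      integrable_finsetSum _ (fun x _ => hg _ _)
    calc _ ≤ ∫ t in Set.Ioc (a r) (b r), ∑ x ∈ X,
          (Set.uIoc (c x r) (x r)).indicator (fun t => 10 * Real.log k * |t - c x r|) t := by
          apply integral_mono_of_nonneg
          · refine Filter.Eventually.of_forall fun t => ?_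
            apply Set.indicator_nonneg
            intro t _
            positivity
          · exact hGi.integrableOn
          · refine Filter.Eventually.of_forall fun t => ?_
            refine Set.indicator_apply_le' (fun ht => ?_)
              (fun _ => Finset.sum_nonneg fun x _ => hg0 _ _ _)
            rw [hE, Finset.card_filter]
            push_cast
            rw [Finset.sum_div, Finset.mul_sum]
            refine Finset.sum_le_sum fun x hx => ?_
            by_cases hm : (x r < t ∧ t ≤ c x r) ∨ (c x r < t ∧ t ≤ x r)
            · have hm' : t ∈ Set.uIoc (c x r) (x r) := by
                rw [Set.mem_uIoc]; exact hm.symm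
              rw [Set.indicator_of_mem hm', if_pos hm]
              have h1 := ht (c x) (hc x hx)
              have h2 : R r * (1 / (f r t : ℝ))
                  = 10 * Real.log k * (R r / (10 * Real.log k * (f r t : ℝ))) := by
                rw [mul_one_div, ← mul_div_assoc (10 * Real.log k),
                  mul_div_mul_left _ _ (by positivity)]
              rw [h2]
              gcongr
            · rw [if_neg hm]
              simpa using hg0 (c x r) (x r) t
      _ ≤ ∫ t, ∑ x ∈ X,
          (Set.uIoc (c x r) (x r)).indicator (fun t => 10 * Real.log k * |t - c x r|) t :=
          setIntegral_le_integral hGi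
            (Filter.Eventually.of_forall fun t => Finset.sum_nonneg fun x _ => hg0 _ _ _)
      _ = _ := by
          rw [integral_finsetSum _ (fun x _ => hg _ _)]
          exact Finset.sum_congr rfl fun x _ => hI _ _
  calc _ ≤ ∑ r : Fin d, ∑ x ∈ X, 5 * Real.log k * (x r - c x r) ^ 2 :=
        Finset.sum_le_sum fun r _ => key r
    _ = _ := by
        rw [Finset.sum_comm, Finset.mul_sum]
        refine Finset.sum_congr rfl fun x _ => ?_
        rw [EuclideanSpace.norm_sq_eq, Finset.mul_sum]
        simp
end

section
/- Let N ≥ 1 be a real number and let 0 < ε < 1. Then ∑_{t=1}^∞ min(N·(1−ε)^{t−1}, 1) ≤ (ln N + 1)/ε. -/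
theorem stmt_4_aux (ε : ℝ) (hε0 : 0 < ε) (hε1 : ε < 1) (n : ℕ) : ∀ N : ℝ, 0 < N →
    ∑ t ∈ Finset.range n, min (N * (1 - ε) ^ t) 1 ≤
      (if 1 ≤ N then Real.log N + 1 else N) / ε := by
  induction n with
  | zero =>
    intro N hN
    simp only [Finset.range_zero, Finset.sum_empty]
    apply div_nonneg _ hε0.le
    split_ifs with h
    · linarith [Real.log_nonneg h]
    · exact hN.le
  | succ n ih =>
    intro N hN
    have hq : 0 < 1 - ε := by linarith
    have h := ih (N * (1 - ε)) (mul_pos hN hq)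
    rw [Finset.sum_range_succ']
    have e : ∀ t : ℕ, N * (1 - ε) ^ (t + 1) = N * (1 - ε) * (1 - ε) ^ t := fun t => by ring
    simp only [e, pow_zero, mul_one]
    rw [le_div_iff₀ hε0] at h ⊢
    rw [add_mul]
    refine (add_le_add_left h _).trans ?_
    by_cases h1 : 1 ≤ N
    · rw [min_eq_right h1, if_pos h1]
      split_ifs with h2
      · rw [Real.log_mul hN.ne' hq.ne']
        linarith [Real.log_le_sub_one_of_pos hq]
      · have h3 := Real.one_sub_inv_le_log_of_pos hN
        have h4 : (1 - ε) * (N - 1) ≤ N⁻¹ * (N - 1) := by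
          apply mul_le_mul_of_nonneg_right _ (by linarith)
          rw [← one_div, le_div_iff₀ hN]
          linarith
        have h5 : N⁻¹ * (N - 1) = 1 - N⁻¹ := by field_simp
        linarith
    · have h2 : ¬ 1 ≤ N * (1 - ε) := by nlinarith
      rw [if_neg h1, if_neg h2, min_eq_left (by linarith)]
      linarith

/-- Let `N ≥ 1` and `0 < ε < 1`. Then `∑_{t=1}^∞ min(N·(1−ε)^{t−1}, 1) ≤ (ln N + 1)/ε`.
(The sum is reindexed by `t ↦ t + 1`, so the exponent `t - 1` becomes `t : ℕ`.) -/
theorem stmt_4 (N ε : ℝ) (hN : 1 ≤ N) (hε0 : 0 < ε) (hε1 : ε < 1) :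
    ∑' t : ℕ, min (N * (1 - ε) ^ t) 1 ≤ (Real.log N + 1) / ε := by
  have hq : 0 < 1 - ε := by linarith
  apply Real.tsum_le_of_sum_range_le
  · intro t
    positivity
  · intro n
    have h := stmt_4_aux ε hε0 hε1 n N (by linarith)
    rwa [if_pos hN] at h
end

section
/- For any nonnegative real numbers R_1, …, R_d and any real numbers α_1, …, α_d, we have (∑_{i=1}^d R_i²·(1 − 2α_i)) · (∑_{i=1}^d R_i²·F(α_i)) ≤ 2·(∑_{i=1}^d R_i²)·(∑_{i=1}^d R_i²·α_i²). -/
/-- The CDF `F` used in the 2-means analysis: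
`F(x) = 0` for `x ≤ 0`, `2x²` for `0 ≤ x ≤ 1/2`, `1 − 2(1−x)²` for `1/2 ≤ x ≤ 1`,
and `1` for `x ≥ 1`. -/
noncomputable def F (x : ℝ) : ℝ :=
  if x ≤ 0 then 0
  else if x ≤ 1 / 2 then 2 * x ^ 2
  else if x ≤ 1 then 1 - 2 * (1 - x) ^ 2
  else 1

lemma F_nonneg (x : ℝ) : 0 ≤ F x := by
  unfold F
  split_ifs <;> nlinarith

lemma F_le (x : ℝ) : F x ≤ 2 * x ^ 2 := by
  unfold F
  split_ifs <;> nlinarith [sq_nonneg (2 * x - 1)]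

lemma F_key (x t : ℝ) (ht : 0 ≤ t) : (1 + 2 * t) * F x ≤ 2 * x ^ 2 + 8 * t * (x + t) := by
  have h2 := F_le x
  by_cases h0 : x ≤ 0
  · have : F x = 0 := by simp [F, h0]
    rw [this]
    nlinarith [sq_nonneg (x + 2 * t)]
  · push Not at h0
    have h3 : F x ≤ 4 * x := by
      unfold F
      split_ifs <;> nlinarith
    nlinarith [mul_le_mul_of_nonneg_left h3 ht, sq_nonneg t]

/-- For nonnegative reals `R_1, …, R_d` and reals `α_1, …, α_d`,
`(∑ R_i²(1 − 2α_i)) · (∑ R_i² F(α_i)) ≤ 2 (∑ R_i²)(∑ R_i² α_i²)`. -/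
theorem stmt_8 (d : ℕ) (R α : Fin d → ℝ) (hR : ∀ i, 0 ≤ R i) :
    (∑ i, R i ^ 2 * (1 - 2 * α i)) * (∑ i, R i ^ 2 * F (α i)) ≤
      2 * (∑ i, R i ^ 2) * (∑ i, R i ^ 2 * α i ^ 2) := by
  have hw : ∀ i, 0 ≤ R i ^ 2 := fun i => sq_nonneg _
  have hW : 0 ≤ ∑ i, R i ^ 2 := Finset.sum_nonneg fun i _ => hw i
  have hS : 0 ≤ ∑ i, R i ^ 2 * F (α i) :=
    Finset.sum_nonneg fun i _ => mul_nonneg (hw i) (F_nonneg _)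
  have hA : ∑ i, R i ^ 2 * (1 - 2 * α i) = ∑ i, R i ^ 2 - 2 * ∑ i, R i ^ 2 * α i := by
    rw [Finset.mul_sum, ← Finset.sum_sub_distrib]
    exact Finset.sum_congr rfl fun i _ => by ring
  have hF : ∑ i, R i ^ 2 * F (α i) ≤ 2 * ∑ i, R i ^ 2 * α i ^ 2 := by
    rw [Finset.mul_sum]
    refine Finset.sum_le_sum fun i _ => ?_
    nlinarith [mul_le_mul_of_nonneg_left (F_le (α i)) (hw i)]
  have hK : ∀ t : ℝ, 0 ≤ t → (1 + 2 * t) * ∑ i, R i ^ 2 * F (α i) ≤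
      2 * ∑ i, R i ^ 2 * α i ^ 2 + 8 * t * (∑ i, R i ^ 2 * α i + t * ∑ i, R i ^ 2) := by
    intro t ht
    simp only [Finset.mul_sum, ← Finset.sum_add_distrib]
    refine Finset.sum_le_sum fun i _ => ?_
    nlinarith [mul_le_mul_of_nonneg_left (F_key (α i) t ht) (hw i)]
  rw [hA]
  generalize ∑ i, R i ^ 2 * F (α i) = S at *
  generalize ∑ i, R i ^ 2 * α i ^ 2 = Q at *
  by_cases h0 : ∑ i, R i ^ 2 = 0
  · have : ∀ i, R i ^ 2 = 0 := fun i =>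
      (Finset.sum_eq_zero_iff_of_nonneg (fun i _ => hw i)).1 h0 i (Finset.mem_univ i)
    simp [this]
  generalize ∑ i, R i ^ 2 * α i = A at *
  generalize ∑ i, R i ^ 2 = W at *
  rcases le_total 0 A with h | h
  · nlinarith [mul_nonneg h hS, mul_le_mul_of_nonneg_left hF hW]
  · have h1 := hK (-A / W) (div_nonneg (by linarith) hW)
    have e1 : A + -A / W * W = 0 := by field_simp; ring
    rw [e1, mul_zero, add_zero] at h1
    have h2 := mul_le_mul_of_nonneg_left h1 hW
    have e2 : W * ((1 + 2 * (-A / W)) * S) = (W - 2 * A) * S := by field_simp; ring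
    rw [e2] at h2
    linarith
end

section
/- Let R_1, …, R_d be nonnegative real numbers with ∑_{i=1}^d R_i² > 0, let α_1, …, α_d be real numbers, and set x = (R_1·α_1, …, R_d·α_d) ∈ ℝ^d and μ₂ = (R_1, …, R_d) ∈ ℝ^d. Let p = (∑_{i=1}^d R_i²·F(α_i)) / (∑_{i=1}^d R_i²). Then (1 − p)·‖x‖₂² + p·‖μ₂ − x‖₂² ≤ 3·‖x‖₂². -/
theorem F_facts (a : ℝ) : 0 ≤ F a ∧ F a ≤ 2 * a ^ 2 ∧ (a ≤ 0 → F a = 0) ∧ (0 ≤ a → F a ≤ 4 * a) := by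
  unfold F
  split_ifs with h1 h2 h3
  · exact ⟨le_refl _, by positivity, fun _ => rfl, fun h => by linarith⟩
  · exact ⟨by positivity, le_refl _, fun h => absurd h h1, fun h => by nlinarith⟩
  · exact ⟨by nlinarith, by nlinarith [sq_nonneg (2 * a - 1)], fun h => absurd h h1,
      fun h => by nlinarith [sq_nonneg (1 - a)]⟩
  · exact ⟨by norm_num, by nlinarith, fun h => absurd h h1, fun h => by linarith⟩

theorem F_point (a q : ℝ) (hq : 0 ≤ q) :
    F a - 2 * q * a - 2 * a ^ 2 ≤ (q / 2) * (q - F a) := by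
  obtain ⟨h0, h1, h2, h3⟩ := F_facts a
  rcases le_total a 0 with h | h
  · rw [h2 h]; nlinarith [sq_nonneg (2 * a + q)]
  · have := mul_le_mul_of_nonneg_left (h3 h) hq
    nlinarith [sq_nonneg q]

/-- With `x = (R_1 α_1, …, R_d α_d)`, `μ₂ = (R_1, …, R_d)` and
`p = (∑ R_i² F(α_i)) / (∑ R_i²)`, we have `(1 − p)‖x‖² + p‖μ₂ − x‖² ≤ 3‖x‖²`. -/
theorem stmt_9 (d : ℕ) (R α : Fin d → ℝ) (hR : ∀ i, 0 ≤ R i)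
    (hpos : 0 < ∑ i, R i ^ 2)
    (x μ₂ : EuclideanSpace ℝ (Fin d))
    (hx : ∀ i, x i = R i * α i) (hμ₂ : ∀ i, μ₂ i = R i)
    (p : ℝ) (hp : p = (∑ i, R i ^ 2 * F (α i)) / ∑ i, R i ^ 2) :
    (1 - p) * ‖x‖ ^ 2 + p * ‖μ₂ - x‖ ^ 2 ≤ 3 * ‖x‖ ^ 2 := by
  have hS := hpos
  have hq : 0 ≤ p := by
    rw [hp]
    exact div_nonneg (Finset.sum_nonneg fun i _ => mul_nonneg (sq_nonneg _) (F_facts _).1) hS.le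
  have hpS : p * ∑ i, R i ^ 2 = ∑ i, R i ^ 2 * F (α i) := by
    rw [hp]; field_simp
  have hX : ‖x‖ ^ 2 = ∑ i, R i ^ 2 * α i ^ 2 := by
    rw [EuclideanSpace.real_norm_sq_eq]
    exact Finset.sum_congr rfl fun i _ => by rw [hx]; ring
  have hM : ‖μ₂ - x‖ ^ 2 = ∑ i, R i ^ 2 - 2 * ∑ i, R i ^ 2 * α i + ∑ i, R i ^ 2 * α i ^ 2 := by
    rw [EuclideanSpace.real_norm_sq_eq, Finset.mul_sum, ← Finset.sum_sub_distrib,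
      ← Finset.sum_add_distrib]
    exact Finset.sum_congr rfl fun i _ => by
      rw [PiLp.sub_apply, hx, hμ₂]; ring
  have key : ∑ i, R i ^ 2 * (F (α i) - 2 * p * α i - 2 * α i ^ 2)
      ≤ ∑ i, R i ^ 2 * ((p / 2) * (p - F (α i))) :=
    Finset.sum_le_sum fun i _ => mul_le_mul_of_nonneg_left (F_point _ _ hq) (sq_nonneg _)
  have e1 : ∑ i, R i ^ 2 * (F (α i) - 2 * p * α i - 2 * α i ^ 2)
      = ∑ i, R i ^ 2 * F (α i) - 2 * p * ∑ i, R i ^ 2 * α i - 2 * ∑ i, R i ^ 2 * α i ^ 2 := by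
    rw [Finset.mul_sum, Finset.mul_sum, ← Finset.sum_sub_distrib, ← Finset.sum_sub_distrib]
    exact Finset.sum_congr rfl fun i _ => by ring
  have e2 : ∑ i, R i ^ 2 * ((p / 2) * (p - F (α i)))
      = (p / 2) * (p * ∑ i, R i ^ 2 - ∑ i, R i ^ 2 * F (α i)) := by
    rw [Finset.mul_sum, ← Finset.sum_sub_distrib, Finset.mul_sum]
    exact Finset.sum_congr rfl fun i _ => by ring
  rw [e1, e2, ← hpS] at key
  rw [hX, hM]
  linarith
end

section
/- Let d ≥ 1, let X ⊆ ℝ^d be a finite set of points, and let μ₁, μ₂ ∈ ℝ^d. Then there exist a coordinate r ∈ {1,…,d}, a threshold t ∈ ℝ, and an ordering (ν₁, ν₂) of the pair (μ₁, μ₂) such that ∑_{x ∈ X, x_r < t} ‖x − ν₁‖₂² + ∑_{x ∈ X, x_r ≥ t} ‖x − ν₂‖₂² ≤ 3·∑_{x ∈ X} min(‖x − μ₁‖₂², ‖x − μ₂‖₂²). -/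
open Finset

noncomputable def triF (u : ℝ) : ℝ :=
  if u ≤ 0 then 0 else if u ≤ 1/2 then 2*u^2 else if u ≤ 1 then 1 - 2*(1-u)^2 else 1

lemma triF_nonneg (u : ℝ) : 0 ≤ triF u := by
  unfold triF; split_ifs <;> nlinarith

lemma triF_le_one (u : ℝ) : triF u ≤ 1 := by
  unfold triF; split_ifs <;> nlinarith

lemma triF_symm (u : ℝ) : triF (1-u) = 1 - triF u := by
  unfold triF
  split_ifs <;> first | (exfalso; linarith) | (ring_nf; done) | skip
  all_goals first
    | (have h : u = 1/2 := by linarith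
       subst h; norm_num)
    | (have h : u = 0 := by linarith
       subst h; norm_num)
    | (have h : u = 1 := by linarith
       subst h; norm_num)

lemma triF_key (u P : ℝ) (hP : 0 ≤ P) :
    triF u - 2*P*u ≤ 2*u^2 + (P^2 - P * triF u) := by
  by_cases h : u ≤ 0
  · have : triF u = 0 := by simp [triF, h]
    rw [this]; nlinarith [sq_nonneg (u+P), sq_nonneg u]
  · push Not at h
    have h1 : triF u ≤ 2*u^2 := by
      unfold triF; split_ifs <;> nlinarith [sq_nonneg (2*u-1)]
    have h2 : triF u ≤ 2*u := by
      unfold triF; split_ifs <;> nlinarith [sq_nonneg (2*u-1)]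
    nlinarith [mul_le_mul_of_nonneg_left h2 hP, sq_nonneg P]

lemma triF_quant (s : ℝ) (hs : s ∈ Set.Ioo (0:ℝ) 1) : ∃ t : ℝ, ∀ u, (s ≤ triF u ↔ t ≤ u) := by
  obtain ⟨h0, h1⟩ := hs
  by_cases h : s ≤ 1/2
  · set t := Real.sqrt (s/2) with ht
    have ht2 : t^2 = s/2 := Real.sq_sqrt (by linarith)
    have htp : 0 < t := Real.sqrt_pos.2 (by linarith)
    have hth : t ≤ 1/2 := by nlinarith
    refine ⟨t, fun u => ?_⟩
    unfold triF
    split_ifs <;> constructor <;> intro hh <;> nlinarith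
  · push Not at h
    set t := Real.sqrt ((1-s)/2) with ht
    have ht2 : t^2 = (1-s)/2 := Real.sq_sqrt (by linarith)
    have htp : 0 < t := Real.sqrt_pos.2 (by linarith)
    have hth : t < 1/2 := by nlinarith
    refine ⟨1-t, fun u => ?_⟩
    unfold triF
    split_ifs <;> constructor <;> intro hh <;> nlinarith

open MeasureTheory in
lemma avg_cut {ι : Type*} (X : Finset ι) (w c : ι → ℝ) (hc0 : ∀ i, 0 ≤ c i) (hc1 : ∀ i, c i ≤ 1) :
    ∃ s ∈ Set.Ioo (0:ℝ) 1, ∑ i ∈ X, w i * (if s ≤ c i then 1 else 0) ≤ ∑ i ∈ X, w i * c i := by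
  have hind : ∀ i, (fun s : ℝ => w i * (if s ≤ c i then (1:ℝ) else 0)) =
      fun s => w i * (Set.Iic (c i)).indicator (fun _ => (1:ℝ)) s := by
    intro i; ext s; simp [Set.indicator]
  have hint : ∀ i, IntegrableOn (fun s : ℝ => w i * (if s ≤ c i then (1:ℝ) else 0))
      (Set.Ioo 0 1) := by
    intro i
    rw [hind]
    apply Integrable.const_mul
    apply Integrable.indicator _ measurableSet_Iic
    exact integrableOn_const (by simp)
  have hval : ∀ i, ∫ s in Set.Ioo (0:ℝ) 1, w i * (if s ≤ c i then (1:ℝ) else 0) = w i * c i := by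
    intro i
    rw [hind, integral_const_mul, ← integral_Ioc_eq_integral_Ioo,
      setIntegral_indicator measurableSet_Iic]
    have : Set.Ioc (0:ℝ) 1 ∩ Set.Iic (c i) = Set.Ioc 0 (c i) := by
      ext s; simp only [Set.mem_inter_iff, Set.mem_Ioc, Set.mem_Iic]
      have := hc1 i
      constructor
      · rintro ⟨⟨a, b⟩, e⟩; exact ⟨a, e⟩
      · rintro ⟨a, b⟩; exact ⟨⟨a, b.trans this⟩, b⟩
    rw [this]; simp [hc0 i]
  have hI : IntegrableOn (fun s : ℝ => ∑ i ∈ X, w i * (if s ≤ c i then (1:ℝ) else 0))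
      (Set.Ioo 0 1) := integrable_finsetSum _ (fun i _ => hint i)
  obtain ⟨s, hs, h⟩ := exists_le_setAverage (μ := volume) (s := Set.Ioo (0:ℝ) 1)
    (by simp) (by simp) hI
  refine ⟨s, hs, h.trans_eq ?_⟩
  rw [setAverage_eq, integral_finsetSum _ (fun i _ => hint i)]
  simp only [hval]
  simp

lemma cut_le {ι : Type*} (X : Finset ι) (w u : ι → ℝ) :
    ∃ t : ℝ, ∑ i ∈ X, w i * (if t ≤ u i then 1 else 0) ≤ ∑ i ∈ X, w i * triF (u i) := by
  obtain ⟨s, hs, h⟩ := avg_cut X w (fun i => triF (u i)) (fun _ => triF_nonneg _)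
    (fun _ => triF_le_one _)
  obtain ⟨t, ht⟩ := triF_quant s hs
  refine ⟨t, ?_⟩
  simpa only [ht] using h

lemma cut_lt {ι : Type*} (X : Finset ι) (w u : ι → ℝ) :
    ∃ t : ℝ, ∑ i ∈ X, w i * (if t < u i then 1 else 0) ≤ ∑ i ∈ X, w i * triF (u i) := by
  obtain ⟨t, h⟩ := cut_le X (fun i => - w i) (fun i => 1 - u i)
  refine ⟨1-t, ?_⟩
  have e1 : ∀ i, w i * (if 1 - t < u i then (1:ℝ) else 0)
      = w i + (- w i) * (if t ≤ 1 - u i then 1 else 0) := by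
    intro i
    split_ifs <;> first | (exfalso; linarith) | ring
  have e2 : ∀ i, w i * triF (u i) = w i + (- w i) * triF (1 - u i) := by
    intro i; rw [triF_symm]; ring
  simp only [e1, e2, sum_add_distrib]
  linarith

lemma expect_key {d : ℕ} (p u : Fin d → ℝ) (hp : ∀ r, 0 ≤ p r) (hs : ∑ r, p r = 1) :
    (∑ r, p r * triF (u r)) * (1 - 2 * ∑ r, p r * u r) ≤ 2 * ∑ r, p r * (u r)^2 := by
  obtain ⟨P, hP⟩ : ∃ P, P = ∑ r, p r * triF (u r) := ⟨_, rfl⟩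
  rw [← hP]
  have hP0 : 0 ≤ P := hP ▸ sum_nonneg fun r _ => mul_nonneg (hp r) (triF_nonneg _)
  have h : ∑ r, p r * (triF (u r) - 2*P*u r) ≤
      ∑ r, p r * (2*(u r)^2 + (P^2 - P * triF (u r))) :=
    sum_le_sum fun r _ => mul_le_mul_of_nonneg_left (triF_key _ _ hP0) (hp r)
  have e1 : ∑ r, p r * (triF (u r) - 2*P*u r) = (∑ r, p r * triF (u r)) - 2*P*∑ r, p r * u r := by
    rw [mul_sum, ← sum_sub_distrib]; exact sum_congr rfl fun r _ => by ring
  have e2 : ∑ r, p r * (2*(u r)^2 + (P^2 - P * triF (u r))) =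
      2 * ∑ r, p r * (u r)^2 + (P^2 * ∑ r, p r - P * ∑ r, p r * triF (u r)) := by
    rw [mul_sum, mul_sum, mul_sum, ← sum_sub_distrib, ← sum_add_distrib]
    exact sum_congr rfl fun r _ => by ring
  rw [e1, e2, hs, ← hP] at h
  nlinarith

lemma point_key {d : ℕ} (a b x : Fin d → ℝ) (N : ℝ) (hN : 0 < N)
    (hNe : N = ∑ r, (b r - a r)^2) :
    (∑ r, (x r - a r)^2) + ((∑ r, (x r - b r)^2) - ∑ r, (x r - a r)^2) *
      (∑ r, (b r - a r)^2 / N * triF ((x r - a r)/(b r - a r))) ≤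
    3 * min (∑ r, (x r - a r)^2) (∑ r, (x r - b r)^2) := by
  set p : Fin d → ℝ := fun r => (b r - a r)^2 / N with hp
  set u : Fin d → ℝ := fun r => (x r - a r)/(b r - a r) with hu
  have hp0 : ∀ r, 0 ≤ p r := fun r => by positivity
  have hs : ∑ r, p r = 1 := by
    rw [hp, ← sum_div, ← hNe]; exact div_self hN.ne'
  have k1 := expect_key p u hp0 hs
  have k2 := expect_key p (fun r => 1 - u r) hp0 hs
  simp only [triF_symm] at k2
  change (∑ r, (x r - a r)^2) + ((∑ r, (x r - b r)^2) - ∑ r, (x r - a r)^2) *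
      (∑ r, p r * triF (u r)) ≤ _
  have s1 : ∑ r, p r * (1 - triF (u r)) = 1 - ∑ r, p r * triF (u r) := by
    simp only [mul_sub, mul_one, sum_sub_distrib, hs]
  have s2 : ∑ r, p r * (1 - u r) = 1 - ∑ r, p r * u r := by
    simp only [mul_sub, mul_one, sum_sub_distrib, hs]
  rw [s1, s2] at k2
  have q1 : N * ∑ r, p r * (u r)^2 ≤ ∑ r, (x r - a r)^2 := by
    rw [mul_sum]; refine sum_le_sum fun r _ => ?_
    simp only [hp, hu]
    by_cases h : b r - a r = 0
    · rw [h]; simp; positivity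
    · apply le_of_eq; field_simp
  have q2 : N * ∑ r, p r * (1 - u r)^2 ≤ ∑ r, (x r - b r)^2 := by
    rw [mul_sum]; refine sum_le_sum fun r _ => ?_
    simp only [hp, hu]
    by_cases h : b r - a r = 0
    · rw [h]; simp; positivity
    · apply le_of_eq; field_simp; ring
  have q3 : (∑ r, (x r - b r)^2) - ∑ r, (x r - a r)^2 = N * (1 - 2 * ∑ r, p r * u r) := by
    rw [mul_sub, mul_one, mul_sum, mul_sum, ← sum_sub_distrib]
    nth_rewrite 1 [hNe]
    rw [← sum_sub_distrib]
    refine sum_congr rfl fun r _ => ?_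
    simp only [hp, hu]
    by_cases h : b r - a r = 0
    · have : b r = a r := by linarith
      simp [this]
    · field_simp; ring
  have k1' := mul_le_mul_of_nonneg_left k1 hN.le
  have k2' := mul_le_mul_of_nonneg_left k2 hN.le
  rw [mul_min_of_nonneg _ _ (by norm_num : (0:ℝ) ≤ 3), le_min_iff]
  constructor
  · rw [q3]; linarith
  · have : (∑ r, (x r - a r)^2) = (∑ r, (x r - b r)^2) - N * (1 - 2 * ∑ r, p r * u r) := by
      linarith
    rw [q3, this]; linarith

/-- Every 2-means instance admits an explainable (single axis-parallel threshold)
clustering whose cost is at most 3 times the cost of clustering with centers `μ₁, μ₂`: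
there are a coordinate `r`, a threshold `t`, and an ordering `(ν₁, ν₂)` of `(μ₁, μ₂)`
such that assigning points with `x_r < t` to `ν₁` and the rest to `ν₂` costs at most
`3 ∑_{x∈X} min(‖x − μ₁‖², ‖x − μ₂‖²)`. -/
theorem stmt_10 (d : ℕ) (hd : 1 ≤ d)
    (X : Finset (EuclideanSpace ℝ (Fin d)))
    (μ₁ μ₂ : EuclideanSpace ℝ (Fin d)) :
    ∃ r : Fin d, ∃ t : ℝ, ∃ ν₁ ν₂ : EuclideanSpace ℝ (Fin d),
      ((ν₁, ν₂) = (μ₁, μ₂) ∨ (ν₁, ν₂) = (μ₂, μ₁)) ∧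
      (∑ x ∈ X.filter (fun x => x r < t), ‖x - ν₁‖ ^ 2) +
        (∑ x ∈ X.filter (fun x => t ≤ x r), ‖x - ν₂‖ ^ 2) ≤
        3 * ∑ x ∈ X, min (‖x - μ₁‖ ^ 2) (‖x - μ₂‖ ^ 2) := by
  have hnorm : ∀ x y : EuclideanSpace ℝ (Fin d), ‖x - y‖^2 = ∑ r, (x r - y r)^2 := by
    intro x y
    rw [EuclideanSpace.norm_sq_eq]; simp
  by_cases hab : ∀ r, μ₂ r - μ₁ r = 0
  · have hE : μ₂ = μ₁ := by
      ext r; linarith [hab r]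
    subst hE
    refine ⟨⟨0, hd⟩, 0, μ₂, μ₂, Or.inl rfl, ?_⟩
    rw [sum_filter, sum_filter, ← sum_add_distrib, mul_sum]
    refine sum_le_sum fun x _ => ?_
    have := sq_nonneg ‖x - μ₂‖
    rw [min_self]
    split_ifs <;> linarith
  push Not at hab
  obtain ⟨r0, hr0⟩ := hab
  obtain ⟨N, hNe⟩ : ∃ N, N = ∑ r, (μ₂ r - μ₁ r)^2 := ⟨_, rfl⟩
  have hN : 0 < N := by
    rw [hNe]
    exact sum_pos' (fun _ _ => sq_nonneg _) ⟨r0, mem_univ _, by positivity⟩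
  have hpt : ∀ x : EuclideanSpace ℝ (Fin d), ‖x - μ₁‖^2 + (‖x - μ₂‖^2 - ‖x - μ₁‖^2) *
      (∑ r, (μ₂ r - μ₁ r)^2 / N * triF ((x r - μ₁ r)/(μ₂ r - μ₁ r))) ≤
      3 * min (‖x - μ₁‖^2) (‖x - μ₂‖^2) := by
    intro x
    rw [hnorm, hnorm]
    exact point_key μ₁ μ₂ x N hN hNe
  set C := 3 * ∑ x ∈ X, min (‖x - μ₁‖ ^ 2) (‖x - μ₂‖ ^ 2) with hC
  set B := ∑ x ∈ X, ‖x - μ₁‖^2 with hB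
  set W : Fin d → ℝ := fun r => ∑ x ∈ X, (‖x - μ₂‖^2 - ‖x - μ₁‖^2) *
      triF ((x r - μ₁ r)/(μ₂ r - μ₁ r)) with hW
  have htot : B + ∑ r, (μ₂ r - μ₁ r)^2 / N * W r ≤ C := by
    have := sum_le_sum (s := X) fun x _ => hpt x
    rw [sum_add_distrib, ← mul_sum] at this
    refine le_trans (le_of_eq ?_) this
    congr 1
    simp only [hW, mul_sum]
    rw [sum_comm]
    exact sum_congr rfl fun x _ => sum_congr rfl fun r _ => by ring
  have hex : ∃ r, μ₂ r - μ₁ r ≠ 0 ∧ B + W r ≤ C := by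
    by_contra hcon
    push Not at hcon
    have hs : ∑ r, (μ₂ r - μ₁ r)^2 / N = 1 := by
      rw [← sum_div, ← hNe]; exact div_self hN.ne'
    have : ∑ r, (μ₂ r - μ₁ r)^2 / N * (C - B) < ∑ r, (μ₂ r - μ₁ r)^2 / N * W r := by
      refine sum_lt_sum (fun r _ => ?_) ⟨r0, mem_univ _, ?_⟩
      · by_cases h : μ₂ r - μ₁ r = 0
        · simp [h]
        · exact mul_le_mul_of_nonneg_left (by linarith [hcon r h]) (by positivity)
      · exact mul_lt_mul_of_pos_left (by linarith [hcon r0 hr0]) (by positivity)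
    rw [← sum_mul, hs] at this
    linarith
  obtain ⟨r, hr, hle⟩ := hex
  rcases lt_or_gt_of_ne hr with hneg | hpos
  · obtain ⟨t, ht⟩ := cut_lt X (fun x => ‖x - μ₂‖^2 - ‖x - μ₁‖^2)
      (fun x => (x r - μ₁ r)/(μ₂ r - μ₁ r))
    refine ⟨r, μ₁ r + t * (μ₂ r - μ₁ r), μ₂, μ₁, Or.inr rfl, ?_⟩
    refine le_trans (le_of_eq ?_) ((add_le_add_right ht B).trans hle)
    rw [sum_filter, sum_filter, ← sum_add_distrib, hB, ← sum_add_distrib]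
    refine sum_congr rfl fun x _ => ?_
    simp only [lt_div_iff_of_neg hneg]
    split_ifs <;> first | (exfalso; linarith) | ring
  · obtain ⟨t, ht⟩ := cut_le X (fun x => ‖x - μ₂‖^2 - ‖x - μ₁‖^2)
      (fun x => (x r - μ₁ r)/(μ₂ r - μ₁ r))
    refine ⟨r, μ₁ r + t * (μ₂ r - μ₁ r), μ₁, μ₂, Or.inl rfl, ?_⟩
    refine le_trans (le_of_eq ?_) ((add_le_add_right ht B).trans hle)
    rw [sum_filter, sum_filter, ← sum_add_distrib, hB, ← sum_add_distrib]
    refine sum_congr rfl fun x _ => ?_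
    simp only [le_div_iff₀ hpos]
    split_ifs <;> first | (exfalso; linarith) | ring
end

section
/- Let x_1, …, x_n ∈ {−1, 1}^d, and let S_1, …, S_k be a partition of {1,…,n}. For i ∈ S_j, define c_i = 0 if |S_j| = 1, and otherwise c_i = (1/(|S_j| − 1))·∑_{i' ∈ S_j, i' ≠ i} ‖x_i − x_{i'}‖₁, the average ℓ₁ distance from x_i to the other points of its cluster. Then for every choice of centers μ_1, …, μ_k ∈ ℝ^d, ∑_{j=1}^k ∑_{i ∈ S_j} ‖x_i − μ_j‖₁ ≥ (1/4)·∑_{i=1}^n c_i. -/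
open Finset

/-- Lower bound on the `k`-medians cost induced by a partition of points of the Boolean
cube `{−1,1}^d`: if `c_i` is the average `ℓ₁` distance from `x_i` to the other points of
its cluster (and `0` for singleton clusters), then for every choice of centers
`μ_1, …, μ_k`, the `k`-medians cost is at least `(1/4) ∑_i c_i`. -/
theorem stmt_11 (n d k : ℕ)
    (x : Fin n → Fin d → ℝ) (hx : ∀ i r, x i r = 1 ∨ x i r = -1)
    (S : Fin k → Finset (Fin n))
    (hpart : ∀ i : Fin n, ∃! j : Fin k, i ∈ S j)
    (c : Fin n → ℝ)
    (hc : ∀ j : Fin k, ∀ i ∈ S j,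
      c i = if (S j).card = 1 then 0
        else (1 / (((S j).card : ℝ) - 1)) *
          ∑ i' ∈ (S j).erase i, ∑ r : Fin d, |x i r - x i' r|)
    (μ : Fin k → Fin d → ℝ) :
    (1 / 4) * ∑ i : Fin n, c i ≤
      ∑ j : Fin k, ∑ i ∈ S j, ∑ r : Fin d, |x i r - μ j r| := by
  have hsum : ∑ i : Fin n, c i = ∑ j : Fin k, ∑ i ∈ S j, c i := by
    have h1 : ∀ j : Fin k, ∑ i ∈ S j, c i = ∑ i : Fin n, if i ∈ S j then c i else 0 := by
      intro j
      rw [← Finset.sum_filter]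
      simp
    rw [Finset.sum_congr rfl (fun j _ => h1 j), Finset.sum_comm]
    refine Finset.sum_congr rfl fun i _ => ?_
    obtain ⟨j, hj, huniq⟩ := hpart i
    rw [Finset.sum_eq_single j]
    · simp [hj]
    · intro b _ hb
      exact if_neg fun h => hb (huniq b h)
    · simp
  rw [hsum, Finset.mul_sum]
  refine Finset.sum_le_sum fun j _ => ?_
  set D : Fin n → ℝ := fun i => ∑ r : Fin d, |x i r - μ j r| with hD
  have hD0 : ∀ i, 0 ≤ D i := fun i => Finset.sum_nonneg fun r _ => abs_nonneg _
  have hT0 : 0 ≤ ∑ i ∈ S j, D i := Finset.sum_nonneg fun i _ => hD0 i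
  change 1 / 4 * ∑ i ∈ S j, c i ≤ ∑ i ∈ S j, D i
  by_cases h1 : (S j).card = 1
  · have : ∑ i ∈ S j, c i = 0 := Finset.sum_eq_zero fun i hi => by rw [hc j i hi, if_pos h1]
    rw [this]; linarith
  by_cases h0 : (S j).card = 0
  · rw [Finset.card_eq_zero] at h0
    simp [h0]
  have h2 : 2 ≤ (S j).card := by omega
  have hm : (0 : ℝ) < ((S j).card : ℝ) - 1 := by
    have : (2 : ℝ) ≤ ((S j).card : ℝ) := by exact_mod_cast h2
    linarith
  have hci : ∀ i ∈ S j, (((S j).card : ℝ) - 1) * c i ≤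
      (((S j).card : ℝ) - 1) * D i + (∑ i' ∈ S j, D i' - D i) := by
    intro i hi
    rw [hc j i hi, if_neg h1, ← mul_assoc, mul_one_div_cancel hm.ne', one_mul]
    calc ∑ i' ∈ (S j).erase i, ∑ r : Fin d, |x i r - x i' r|
        ≤ ∑ i' ∈ (S j).erase i, (D i + D i') := by
          refine Finset.sum_le_sum fun i' _ => ?_
          rw [hD]
          simp only
          rw [← Finset.sum_add_distrib]
          refine Finset.sum_le_sum fun r _ => ?_
          rw [abs_sub_comm (x i' r)]
          exact abs_sub_le _ _ _
      _ = _ := by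
          rw [Finset.sum_add_distrib, Finset.sum_const, nsmul_eq_mul,
            Finset.card_erase_of_mem hi, Nat.cast_sub (by omega), Nat.cast_one,
            ← Finset.add_sum_erase _ D hi]
          ring
  have hs := Finset.sum_le_sum hci
  rw [← Finset.mul_sum, Finset.sum_add_distrib, ← Finset.mul_sum, Finset.sum_sub_distrib,
    Finset.sum_const, nsmul_eq_mul] at hs
  have h3 : ∑ i ∈ S j, c i ≤ 2 * ∑ i ∈ S j, D i := by
    refine le_of_mul_le_mul_left ?_ hm
    linarith
  linarith
end

section
/- There exist absolute constants C, c > 0 such that for all integers k ≥ 2 and d ≥ C·ln k the following holds: if π_1, …, π_d are independent uniformly random permutations of {1,…,k} and, for each i ∈ {1,…,k}, μ_i = (π_1(i), π_2(i), …, π_d(i)) ∈ ℝ^d, then with probability at least 1/2, ‖μ_i − μ_j‖₂ ≥ c·k·√d for all i ≠ j. -/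
open Finset

/-- The coordinate permutation `σ` brings `i` and `j` close together. -/
def CloseAt {k : ℕ} (i j : Fin k) (σ : Equiv.Perm (Fin k)) : Prop :=
  64 * |((σ i : ℕ) : ℤ) - ((σ j : ℕ) : ℤ)| < (k : ℤ)

instance {k : ℕ} (i j : Fin k) : DecidablePred (CloseAt i j) := fun _ => by
  unfold CloseAt; infer_instance

lemma exists_perm_two {k : ℕ} {i j i' j' : Fin k} (h : i ≠ j) (h' : i' ≠ j') :
    ∃ τ : Equiv.Perm (Fin k), τ i = i' ∧ τ j = j' := by
  refine ⟨Equiv.swap (Equiv.swap i i' j) j' * Equiv.swap i i', ?_, ?_⟩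
  · have h1 : i' ≠ Equiv.swap i i' j := by
      intro h2
      have h3 : Equiv.swap i i' i = Equiv.swap i i' j := by
        rw [Equiv.swap_apply_left]; exact h2
      exact h ((Equiv.swap i i').injective h3)
    simp only [Equiv.Perm.mul_apply, Equiv.swap_apply_left]
    exact Equiv.swap_apply_of_ne_of_ne h1 h'
  · simp

lemma card_close_eq {k : ℕ} {i j i' j' : Fin k} (h : i ≠ j) (h' : i' ≠ j') :
    (univ.filter (CloseAt i j)).card = (univ.filter (CloseAt i' j')).card := by
  obtain ⟨τ, h1, h2⟩ := exists_perm_two h' h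
  refine Finset.card_bij (fun σ _ => σ * τ) ?_ ?_ ?_
  · intro σ hσ
    simp only [mem_filter, mem_univ, true_and, CloseAt, Equiv.Perm.mul_apply, h1, h2] at hσ ⊢
    exact hσ
  · intro a _ b _ hab
    exact mul_right_cancel hab
  · intro σ hσ
    refine ⟨σ * τ⁻¹, ?_, by simp⟩
    have e1 : τ⁻¹ i = i' := by rw [← h1]; simp
    have e2 : τ⁻¹ j = j' := by rw [← h2]; simp
    simp only [mem_filter, mem_univ, true_and, CloseAt, Equiv.Perm.mul_apply, e1, e2] at hσ ⊢
    exact hσ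

lemma card_near {k : ℕ} (x : Fin k) :
    (univ.filter (fun y : Fin k => x ≠ y ∧ 64 * |((x : ℕ) : ℤ) - ((y : ℕ) : ℤ)| < (k : ℤ))).card
      ≤ 2 * (k / 64) := by
  have hc : ((Finset.Icc (-((k / 64 : ℕ) : ℤ)) ((k / 64 : ℕ) : ℤ)).erase 0).card
      = 2 * (k / 64) := by
    rw [Finset.card_erase_of_mem (by simp; omega), Int.card_Icc]
    omega
  rw [← hc]
  refine Finset.card_le_card_of_injOn (fun y => ((x : ℕ) : ℤ) - ((y : ℕ) : ℤ)) ?_ ?_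
  · intro y hy
    simp only [coe_filter, mem_univ, true_and, Set.mem_ofPred_eq] at hy
    obtain ⟨h1, h2⟩ := hy
    have h3 : (x : ℕ) ≠ y := fun h => h1 (Fin.ext h)
    have h4 := abs_lt.mp (show |64 * (((x : ℕ) : ℤ) - ((y : ℕ) : ℤ))| < (k : ℤ) by
      rw [abs_mul]; simpa using h2)
    simp only [coe_erase, coe_Icc, Set.mem_sdiff, Set.mem_Icc, Set.mem_singleton_iff]
    push_cast
    refine ⟨⟨?_, ?_⟩, ?_⟩ <;> omega
  · intro a _ b _ hab
    apply Fin.ext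
    simp only at hab
    omega

lemma card_close_le {k : ℕ} (hk : 2 ≤ k) {i j : Fin k} (h : i ≠ j) :
    16 * (univ.filter (CloseAt i j)).card ≤ Fintype.card (Equiv.Perm (Fin k)) := by
  set M := (univ.filter (CloseAt i j)).card with hM
  set N := Fintype.card (Equiv.Perm (Fin k)) with hN
  have key : k * (k - 1) * M ≤ N * (k * (2 * (k / 64))) := by
    have e1 : k * (k - 1) * M = ∑ p ∈ (univ : Finset (Fin k)).offDiag,
        (univ.filter (CloseAt p.1 p.2)).card := by
      rw [Finset.sum_congr rfl (fun p hp =>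
        card_close_eq (i' := i) (j' := j) (by simpa using hp) h), Finset.sum_const,
        Finset.offDiag_card]
      simp [hM, Nat.mul_sub]
    have e2 : ∑ p ∈ (univ : Finset (Fin k)).offDiag, (univ.filter (CloseAt p.1 p.2)).card
        = ∑ σ : Equiv.Perm (Fin k),
          (((univ : Finset (Fin k)).offDiag).filter (fun p => CloseAt p.1 p.2 σ)).card := by
      simp only [Finset.card_filter]
      rw [Finset.sum_comm]
    rw [e1, e2]
    have e3 : ∀ σ ∈ (univ : Finset (Equiv.Perm (Fin k))),
        (((univ : Finset (Fin k)).offDiag).filter (fun p => CloseAt p.1 p.2 σ)).card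
          ≤ k * (2 * (k / 64)) := by
      intro σ _
      have : (((univ : Finset (Fin k)).offDiag).filter (fun p => CloseAt p.1 p.2 σ)).card
        ≤ ((univ : Finset (Fin k)).sigma (fun x => univ.filter (fun y : Fin k =>
            x ≠ y ∧ 64 * |((x : ℕ) : ℤ) - ((y : ℕ) : ℤ)| < (k : ℤ)))).card := by
        refine Finset.card_le_card_of_injOn (fun p => ⟨σ p.1, σ p.2⟩) ?_ ?_
        · intro p hp
          have hp' := Finset.mem_filter.mp (Finset.mem_coe.mp hp)
          simp [CloseAt] at hp' ⊢
          exact hp'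
        · rintro ⟨a, b⟩ _ ⟨a', b'⟩ _ hab
          simp at hab
          simp [hab]
      refine this.trans ?_
      rw [Finset.card_sigma]
      refine (Finset.sum_le_sum (fun x _ => card_near x)).trans ?_
      simp
    refine (Finset.sum_le_sum e3).trans ?_
    simp [hN]
  obtain ⟨m, rfl⟩ : ∃ m, k = m + 2 := ⟨k - 2, by omega⟩
  have h2 : (m + 1) * M ≤ N * (2 * ((m + 2) / 64)) := by
    have : (m + 2) * ((m + 1) * M) ≤ (m + 2) * (N * (2 * ((m + 2) / 64))) := by
      calc _ = (m + 2) * (m + 2 - 1) * M := by rw [show m + 2 - 1 = m + 1 from rfl]; ring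
        _ ≤ _ := key
        _ = _ := by ring
    exact Nat.le_of_mul_le_mul_left this (by omega)
  have h3 : 32 * ((m + 2) / 64) ≤ m + 1 := by omega
  have h4 : (m + 1) * (16 * M) ≤ (m + 1) * N := by nlinarith
  exact Nat.le_of_mul_le_mul_left h4 (by omega)

/-- the tuples for which the pair `i, j` has many close coordinates -/
lemma card_many_close {k d : ℕ} (hk : 2 ≤ k) {i j : Fin k} (h : i ≠ j) :
    (univ.filter (fun π : Fin d → Equiv.Perm (Fin k) =>
      d ≤ 2 * (univ.filter (fun r => CloseAt i j (π r))).card)).card * 2 ^ d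
      ≤ Fintype.card (Fin d → Equiv.Perm (Fin k)) := by
  set S := univ.filter (fun π : Fin d → Equiv.Perm (Fin k) =>
      d ≤ 2 * (univ.filter (fun r => CloseAt i j (π r))).card) with hS
  set N := Fintype.card (Equiv.Perm (Fin k)) with hN
  have hT : Fintype.card (Fin d → Equiv.Perm (Fin k)) = N ^ d := by
    rw [Fintype.card_fun, Fintype.card_fin]
  let f : Equiv.Perm (Fin k) → ℕ := fun σ => if CloseAt i j σ then 16 else 1
  have hf : ∑ σ, f σ ≤ 2 * N := by
    have e : ∑ σ, f σ ≤ ∑ σ : Equiv.Perm (Fin k), (1 + 16 * (if CloseAt i j σ then 1 else 0)) := by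
      apply Finset.sum_le_sum
      intro σ _
      simp only [f]
      split_ifs <;> simp
    refine e.trans ?_
    rw [Finset.sum_add_distrib, ← Finset.mul_sum, ← Finset.card_filter]
    have := card_close_le hk h
    simp only [sum_const, smul_eq_mul, mul_one, card_univ]
    rw [two_mul]
    exact Nat.add_le_add le_rfl this
  have hprod : ∑ π : Fin d → Equiv.Perm (Fin k), ∏ r, f (π r) = (∑ σ, f σ) ^ d := by
    have := (Finset.prod_univ_sum (fun _ : Fin d => (univ : Finset (Equiv.Perm (Fin k))))
      (fun _ σ => f σ))
    simp only [prod_const, card_univ, Fintype.card_fin, Fintype.piFinset_univ] at this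
    exact this.symm
  have hlow : S.card * 4 ^ d ≤ ∑ π : Fin d → Equiv.Perm (Fin k), ∏ r, f (π r) := by
    calc S.card * 4 ^ d = ∑ π ∈ S, 4 ^ d := by simp
      _ ≤ ∑ π ∈ S, ∏ r, f (π r) := by
        apply Finset.sum_le_sum
        intro π hπ
        have hπ' := (Finset.mem_filter.mp hπ).2
        have : ∏ r, f (π r) = 16 ^ (univ.filter (fun r => CloseAt i j (π r))).card := by
          simp only [f]
          rw [Finset.prod_ite]
          simp
        rw [this, show (16 : ℕ) = 4 ^ 2 by norm_num, ← pow_mul]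
        exact Nat.pow_le_pow_right (by norm_num) hπ'
      _ ≤ _ := Finset.sum_le_univ_sum_of_nonneg (fun _ => Nat.zero_le _)
  have h5 : 2 ^ d * (S.card * 2 ^ d) ≤ 2 ^ d * N ^ d := by
    calc 2 ^ d * (S.card * 2 ^ d) = S.card * 4 ^ d := by
          rw [show (4 : ℕ) = 2 * 2 by norm_num, mul_pow]; ring
      _ ≤ (∑ σ, f σ) ^ d := hprod ▸ hlow
      _ ≤ (2 * N) ^ d := Nat.pow_le_pow_left hf d
      _ = _ := mul_pow _ _ _
  rw [hT]
  exact Nat.le_of_mul_le_mul_left h5 (by positivity)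

lemma many_close_of_short {k d : ℕ} (π : Fin d → Equiv.Perm (Fin k)) (i j : Fin k)
    (h : ¬ ((1 / 128 : ℝ) * k * Real.sqrt d ≤
                  Real.sqrt (∑ r : Fin d,
                    ((((π r i : ℕ) : ℝ) + 1) - (((π r j : ℕ) : ℝ) + 1)) ^ 2))) :
    d ≤ 2 * (univ.filter (fun r => CloseAt i j (π r))).card := by
  by_contra hlt
  push Not at hlt
  apply h
  apply Real.le_sqrt_of_sq_le
  rw [mul_pow, mul_pow, Real.sq_sqrt (Nat.cast_nonneg d)]
  have hcard := Finset.card_filter_add_card_filter_not (s := (univ : Finset (Fin d)))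
    (fun r => CloseAt i j (π r))
  set G := univ.filter (fun r => ¬ CloseAt i j (π r)) with hG
  have hGd : (d : ℝ) ≤ 2 * (G.card : ℝ) := by
    have : d ≤ 2 * G.card := by
      rw [card_univ, Fintype.card_fin] at hcard
      omega
    exact_mod_cast this
  have h1 : (G.card : ℝ) * ((k : ℝ) / 64) ^ 2 ≤ ∑ r : Fin d,
      ((((π r i : ℕ) : ℝ) + 1) - (((π r j : ℕ) : ℝ) + 1)) ^ 2 := by
    calc (G.card : ℝ) * ((k : ℝ) / 64) ^ 2 = ∑ r ∈ G, ((k : ℝ) / 64) ^ 2 := by simp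
      _ ≤ ∑ r ∈ G, ((((π r i : ℕ) : ℝ) + 1) - (((π r j : ℕ) : ℝ) + 1)) ^ 2 := by
        apply Finset.sum_le_sum
        intro r hr
        have hr' := (Finset.mem_filter.mp hr).2
        simp only [CloseAt, not_lt] at hr'
        have hr2 : (k : ℝ) ≤ 64 * |((π r i : ℕ) : ℝ) - ((π r j : ℕ) : ℝ)| := by exact_mod_cast hr'
        rw [add_sub_add_right_eq_sub, ← sq_abs (((π r i : ℕ) : ℝ) - ((π r j : ℕ) : ℝ))]
        apply pow_le_pow_left₀ (by positivity)
        linarith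
      _ ≤ _ := Finset.sum_le_univ_sum_of_nonneg (fun _ => sq_nonneg _)
  refine le_trans ?_ h1
  have : 0 ≤ (k : ℝ) ^ 2 := sq_nonneg _
  have hG0 : (0 : ℝ) ≤ G.card := Nat.cast_nonneg _
  nlinarith [mul_le_mul_of_nonneg_left hGd this, mul_nonneg this hG0]

/-- There are absolute constants `C, c > 0` such that for all `k ≥ 2` and `d ≥ C ln k`:
if `π_1, …, π_d` are independent uniformly random permutations of `{1,…,k}` and
`μ_i = (π_1(i), …, π_d(i)) ∈ ℝ^d` (a permutation value `π_r(i) ∈ Fin k` is realized as the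
real number `π_r(i) + 1 ∈ {1,…,k}`), then with probability at least `1/2` all pairwise
Euclidean distances `‖μ_i − μ_j‖₂`, `i ≠ j`, are at least `c·k·√d`. (The probability is
expressed by counting `d`-tuples of permutations.) -/
theorem stmt_13 :
    ∃ C c : ℝ, 0 < C ∧ 0 < c ∧
      ∀ k d : ℕ, 2 ≤ k → C * Real.log k ≤ (d : ℝ) →
        (1 / 2 : ℝ) * (Fintype.card (Fin d → Equiv.Perm (Fin k)) : ℝ) ≤
          ((univ.filter (fun π : Fin d → Equiv.Perm (Fin k) =>
              ∀ i j : Fin k, i ≠ j →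
                c * k * Real.sqrt d ≤
                  Real.sqrt (∑ r : Fin d,
                    ((((π r i : ℕ) : ℝ) + 1) - (((π r j : ℕ) : ℝ) + 1)) ^ 2))).card : ℝ) := by
  refine ⟨6, 1 / 128, by norm_num, by norm_num, ?_⟩
  intro k d hk hd
  set T := Fintype.card (Fin d → Equiv.Perm (Fin k)) with hT
  set P : (Fin d → Equiv.Perm (Fin k)) → Prop := fun π => ∀ i j : Fin k, i ≠ j →
                (1 / 128 : ℝ) * k * Real.sqrt d ≤
                  Real.sqrt (∑ r : Fin d,
                    ((((π r i : ℕ) : ℝ) + 1) - (((π r j : ℕ) : ℝ) + 1)) ^ 2) with hP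
  have hpow : 2 * (k : ℝ) ^ 2 ≤ 2 ^ d := by
    have hk' : (2 : ℝ) ≤ k := by exact_mod_cast hk
    have hl2 : (1 / 2 : ℝ) < Real.log 2 := by have := Real.log_two_gt_d9; linarith
    have hlk : Real.log 2 ≤ Real.log k := Real.log_le_log (by norm_num) hk'
    rw [← Real.log_le_log_iff (by positivity) (by positivity), Real.log_pow,
      Real.log_mul (by norm_num) (by positivity), Real.log_pow]
    push_cast
    have : 6 * Real.log k * (1 / 2) ≤ d * Real.log 2 :=
      mul_le_mul hd hl2.le (by norm_num) (Nat.cast_nonneg d)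
    linarith
  have hpowN : 2 * k ^ 2 ≤ 2 ^ d := by exact_mod_cast hpow
  classical
  have hbad : (univ.filter (fun π => ¬ P π)).card * 2 ^ d ≤ k ^ 2 * T := by
    have hsub : univ.filter (fun π => ¬ P π) ⊆ (univ : Finset (Fin k)).offDiag.biUnion
        (fun p => univ.filter (fun π : Fin d → Equiv.Perm (Fin k) =>
      d ≤ 2 * (univ.filter (fun r => CloseAt p.1 p.2 (π r))).card)) := by
      intro π hπ
      have hπ' := (Finset.mem_filter.mp hπ).2
      simp only [hP] at hπ'
      push Not at hπ'
      obtain ⟨i, j, hij, hlt⟩ := hπ'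
      rw [Finset.mem_biUnion]
      refine ⟨(i, j), by simpa using hij, ?_⟩
      rw [Finset.mem_filter]
      exact ⟨mem_univ _, many_close_of_short π i j (not_le.mpr hlt)⟩
    calc _ ≤ (∑ p ∈ (univ : Finset (Fin k)).offDiag,
          (univ.filter (fun π : Fin d → Equiv.Perm (Fin k) =>
      d ≤ 2 * (univ.filter (fun r => CloseAt p.1 p.2 (π r))).card)).card) * 2 ^ d :=
          Nat.mul_le_mul_right _ ((Finset.card_le_card hsub).trans Finset.card_biUnion_le)
      _ ≤ ∑ p ∈ (univ : Finset (Fin k)).offDiag, T := by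
          rw [Finset.sum_mul]
          exact Finset.sum_le_sum (fun p hp => card_many_close hk (by simpa using hp))
      _ ≤ k ^ 2 * T := by
          rw [Finset.sum_const, Finset.offDiag_card, smul_eq_mul]
          apply Nat.mul_le_mul_right
          simp [sq]
  have hbad2 : 2 * (univ.filter (fun π => ¬ P π)).card ≤ T := by
    have : k ^ 2 * (2 * (univ.filter (fun π => ¬ P π)).card) ≤ k ^ 2 * T := by
      calc _ = (univ.filter (fun π => ¬ P π)).card * (2 * k ^ 2) := by ring
        _ ≤ _ := Nat.mul_le_mul_left _ hpowN
        _ ≤ _ := hbad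
    exact Nat.le_of_mul_le_mul_left this (by positivity)
  have hsum := Finset.card_filter_add_card_filter_not
    (s := (univ : Finset (Fin d → Equiv.Perm (Fin k)))) P
  rw [card_univ, ← hT] at hsum
  have hfin : T ≤ 2 * (univ.filter P).card := by omega
  have hfin' : (T : ℝ) ≤ 2 * ((univ.filter P).card : ℝ) := by exact_mod_cast hfin
  have hfin2 : (1 / 2 : ℝ) * T ≤ ((univ.filter P).card : ℝ) := by linarith
  convert hfin2
end
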